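/- arXiv:1010.3060 — 4 statements merged into one kernel-verified Lean document; each statement's English description precedes it below -/
import Mathlib

section
/- Let Ω be a Hermitian N×N complex matrix, let a, b be real numbers with a > b, and suppose there are two decompositions ℂ^N = A ⊕ R and ℂ^N = A' ⊕ R' into complementary subspaces such that ⟨x, Ωx⟩ ≥ a for every unit vector x ∈ A and every unit vector x ∈ A', and ⟨x, Ωx⟩ ≤ b for every unit vector x ∈ R and every unit vector x ∈ R'. Then dim A = dim A'. -/
open Matrix

open scoped ComplexOrder in
theorem exists_smul_star_dotProduct_self_eq_one {n : Type*} [Fintype n] {x : n → ℂ}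
    (hx : x ≠ 0) : ∃ c : ℂ, star (c • x) ⬝ᵥ (c • x) = 1 := by
  obtain ⟨hr, hi⟩ := Complex.pos_iff.mp (dotProduct_star_self_pos_iff.mpr hx)
  set r : ℝ := (star x ⬝ᵥ x).re with hr_def
  have hxr : star x ⬝ᵥ x = (r : ℂ) := Complex.ext rfl (by simpa using hi.symm)
  refine ⟨((√r)⁻¹ : ℝ), ?_⟩
  rw [star_smul, smul_dotProduct, dotProduct_smul, hxr, smul_eq_mul, smul_eq_mul,
    Complex.star_def, Complex.conj_ofReal]
  norm_cast
  have hs : √r ≠ 0 := (Real.sqrt_pos.mpr hr).ne'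
  field_simp
  exact (Real.sq_sqrt hr.le).symm

theorem disjoint_of_quadraticForm_separated {n : Type*} [Fintype n] {M : Matrix n n ℂ}
    {a b : ℝ} (hab : b < a) {A R : Submodule ℂ (n → ℂ)}
    (hA : ∀ x ∈ A, star x ⬝ᵥ x = 1 → a ≤ (star x ⬝ᵥ M.mulVec x).re)
    (hR : ∀ x ∈ R, star x ⬝ᵥ x = 1 → (star x ⬝ᵥ M.mulVec x).re ≤ b) :
    Disjoint A R := by
  rw [Submodule.disjoint_def]
  intro x hxA hxR
  by_contra hx
  obtain ⟨c, hc⟩ := exists_smul_star_dotProduct_self_eq_one hx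
  exact hab.not_ge <|
    (hA _ (A.smul_mem c hxA) hc).trans (hR _ (R.smul_mem c hxR) hc)

/-- If a Hermitian matrix Ω admits two decompositions ℂ^N = A ⊕ R = A' ⊕ R' with
quadratic form ≥ a on unit vectors of A, A' and ≤ b on unit vectors of R, R', a > b,
then dim A = dim A'. -/
theorem dim_accepting_subspace_well_defined
    {N : ℕ} (Ω : Matrix (Fin N) (Fin N) ℂ) (hΩ : Ω.IsHermitian)
    (a b : ℝ) (hab : a > b)
    (A R A' R' : Submodule ℂ (Fin N → ℂ))
    (hAR : IsCompl A R) (hAR' : IsCompl A' R')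
    (hA : ∀ x ∈ A, star x ⬝ᵥ x = 1 → a ≤ (star x ⬝ᵥ Ω.mulVec x).re)
    (hA' : ∀ x ∈ A', star x ⬝ᵥ x = 1 → a ≤ (star x ⬝ᵥ Ω.mulVec x).re)
    (hR : ∀ x ∈ R, star x ⬝ᵥ x = 1 → (star x ⬝ᵥ Ω.mulVec x).re ≤ b)
    (hR' : ∀ x ∈ R', star x ⬝ᵥ x = 1 → (star x ⬝ᵥ Ω.mulVec x).re ≤ b) :
    Module.finrank ℂ A = Module.finrank ℂ A' := by
  have h₁ := Submodule.finrank_add_finrank_le_of_disjoint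
    (disjoint_of_quadraticForm_separated hab hA hR')
  have h₂ := Submodule.finrank_add_finrank_le_of_disjoint
    (disjoint_of_quadraticForm_separated hab hA' hR)
  have h₃ := Submodule.finrank_add_eq_of_isCompl hAR
  have h₄ := Submodule.finrank_add_eq_of_isCompl hAR'
  omega
end

section
/- Let T ≥ 1 and let E be the (T+1)×(T+1) real symmetric tridiagonal matrix with diagonal entries E₀₀ = E_TT = 1/2 and E_tt = 1 for 0 < t < T, off-diagonal entries E_{t,t+1} = E_{t+1,t} = −1/2 for 0 ≤ t < T, and all other entries zero. Then the eigenvalues of E, counted with multiplicity, are exactly the T+1 distinct numbers 1 − cos(nπ/(T+1)) for n = 0, 1, …, T. -/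
open Matrix Real

/-- Second-order difference equation satisfied by the cosine. -/
theorem cos_sub_half_sum_neighbours (x θ : ℝ) :
    cos x - (cos (x - θ) + cos (x + θ)) / 2 = (1 - cos θ) * cos x := by
  rw [cos_sub, cos_add]
  ring

/-- Reflection of the cosine at a multiple of `π`. -/
theorem cos_nat_mul_pi_add_eq_sub (n : ℕ) (y : ℝ) :
    cos (n * π + y) = cos (n * π - y) := by
  rw [cos_add, cos_sub, sin_nat_mul_pi]
  ring

/-- The sampled cosines `cos (θ (t + 1/2))` with `θ (T + 1) = n π` form an eigenvector of the
hopping matrix for the eigenvalue `1 - cos θ`. -/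
theorem hopping_mulVec_cos
    (T : ℕ) (hT : 1 ≤ T) (E : Matrix (Fin (T + 1)) (Fin (T + 1)) ℝ)
    (hE : ∀ t s : Fin (T + 1), E t s =
      if t = s then (if (t : ℕ) = 0 ∨ (t : ℕ) = T then (1 : ℝ) / 2 else 1)
      else if (t : ℕ) + 1 = (s : ℕ) ∨ (s : ℕ) + 1 = (t : ℕ) then -(1 / 2) else 0)
    (n : ℕ) (θ : ℝ) (hθ : θ * (T + 1) = n * π) :
    E *ᵥ (fun t : Fin (T + 1) => cos (θ * ((t : ℕ) + 1 / 2))) =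
      (1 - cos θ) • fun t : Fin (T + 1) => cos (θ * ((t : ℕ) + 1 / 2)) := by
  funext t
  have hsum : (E *ᵥ fun t : Fin (T + 1) => cos (θ * ((t : ℕ) + 1 / 2))) t =
      ∑ s ∈ Finset.range (T + 1),
        ((if (t : ℕ) = s then
            (if (t : ℕ) = 0 ∨ (t : ℕ) = T then (1 : ℝ) / 2 else 1) * cos (θ * (s + 1 / 2))
          else 0) +
          (if (t : ℕ) + 1 = s then -(1 / 2) * cos (θ * (s + 1 / 2)) else 0) +
          (if s + 1 = (t : ℕ) then -(1 / 2) * cos (θ * (s + 1 / 2)) else 0)) := by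
    rw [Finset.sum_range, mulVec, dotProduct]
    refine Finset.sum_congr rfl fun s _ => ?_
    rw [hE]
    simp only [Fin.ext_iff]
    by_cases h₁ : (t : ℕ) = s
    · simp [h₁]
    · by_cases h₂ : (t : ℕ) + 1 = s
      · have h₃ : ¬ (s : ℕ) + 1 = t := by omega
        simp [h₁, h₂, h₃]
      · by_cases h₃ : (s : ℕ) + 1 = t <;> simp [h₁, h₂, h₃]
  rw [hsum, Finset.sum_add_distrib, Finset.sum_add_distrib, Finset.sum_ite_eq, Finset.sum_ite_eq]
  obtain ⟨t, ht⟩ := t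
  simp only [Pi.smul_apply, smul_eq_mul, Finset.mem_range, ht, if_true]
  rw [← cos_sub_half_sum_neighbours]
  have hright : (if t + 1 < T + 1 then -(1 / 2) * cos (θ * ((t + 1 : ℕ) + 1 / 2)) else 0) =
      -(1 / 2) * cos (θ * (t + 1 / 2) + θ) +
        (if t = T then 1 / 2 * cos (θ * (t + 1 / 2)) else 0) := by
    by_cases h : t = T
    · subst h
      have h₁ : θ * (t + 1 / 2) + θ = n * π + θ / 2 := by rw [← hθ]; ring
      have h₂ : θ * (t + 1 / 2) = n * π - θ / 2 := by rw [← hθ]; ring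
      rw [h₁, h₂, cos_nat_mul_pi_add_eq_sub]
      simp
    · have h' : t + 1 < T + 1 := by omega
      rw [if_pos h', if_neg h]
      push_cast
      ring_nf
  have hleft : ∑ s ∈ Finset.range (T + 1),
      (if s + 1 = t then -(1 / 2) * cos (θ * ((s : ℝ) + 1 / 2)) else 0) =
      -(1 / 2) * cos (θ * (t + 1 / 2) - θ) +
        (if t = 0 then 1 / 2 * cos (θ * (t + 1 / 2)) else 0) := by
    rcases t with _ | k
    · have h₁ : θ * (((0 : ℕ) : ℝ) + 1 / 2) - θ = -(θ * (((0 : ℕ) : ℝ) + 1 / 2)) := by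
        push_cast
        ring
      rw [h₁, cos_neg]
      simp
    · have hk : k < T + 1 := by omega
      simp only [Nat.add_right_cancel_iff, Finset.sum_ite_eq', Finset.mem_range, hk, if_true,
        Nat.add_eq_zero_iff, one_ne_zero, and_false, if_false]
      push_cast
      ring_nf
  rw [hright, hleft]
  by_cases h₀ : t = 0
  · simp only [h₀, true_or, if_true, if_neg (show ¬ 0 = T by omega)]
    ring
  · by_cases h₁ : t = T
    · simp only [h₁, or_true, if_true, if_neg (show ¬ T = 0 by omega)]
      ring
    · simp only [h₀, h₁, or_self, if_false]
      ring

/-- The eigenvalues of the clock-register hopping matrix E, counted with multiplicity,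
are exactly the T+1 distinct numbers 1 − cos(nπ/(T+1)), n = 0,…,T. -/
theorem hopping_matrix_spectrum
    (T : ℕ) (hT : 1 ≤ T) (E : Matrix (Fin (T + 1)) (Fin (T + 1)) ℝ)
    (hE : ∀ t s : Fin (T + 1), E t s =
      if t = s then (if (t : ℕ) = 0 ∨ (t : ℕ) = T then (1 : ℝ) / 2 else 1)
      else if (t : ℕ) + 1 = (s : ℕ) ∨ (s : ℕ) + 1 = (t : ℕ) then -(1 / 2) else 0)
    (hHerm : E.IsHermitian) :
    Function.Injective (fun n : Fin (T + 1) => 1 - Real.cos ((n : ℕ) * π / (T + 1))) ∧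
      ∃ σ : Equiv.Perm (Fin (T + 1)),
        ∀ n : Fin (T + 1),
          hHerm.eigenvalues (σ n) = 1 - Real.cos ((n : ℕ) * π / (T + 1)) := by
  have hpos : (0 : ℝ) < T + 1 := by positivity
  have hnonneg : ∀ n : Fin (T + 1), 0 ≤ (n : ℕ) * π / ((T : ℝ) + 1) := fun n => by positivity
  have hlt : ∀ n : Fin (T + 1), (n : ℕ) * π / ((T : ℝ) + 1) < π := fun n => by
    rw [div_lt_iff₀ hpos, mul_comm]
    exact mul_lt_mul_of_pos_left (by exact_mod_cast n.isLt) pi_pos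
  have hinj : Function.Injective
      (fun n : Fin (T + 1) => 1 - Real.cos ((n : ℕ) * π / (T + 1))) := by
    intro m n h
    have h' := injOn_cos ⟨hnonneg m, (hlt m).le⟩ ⟨hnonneg n, (hlt n).le⟩ (sub_right_injective h)
    rw [div_left_inj' hpos.ne', mul_left_inj' pi_ne_zero] at h'
    exact Fin.ext (by exact_mod_cast h')
  have hmem : ∀ n : Fin (T + 1), ∃ i, hHerm.eigenvalues i =
      1 - Real.cos ((n : ℕ) * π / (T + 1)) := by
    intro n
    rw [← Set.mem_range, ← hHerm.spectrum_real_eq_range_eigenvalues, ← Matrix.spectrum_toLin',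
      ← Module.End.hasEigenvalue_iff_mem_spectrum]
    refine Module.End.hasEigenvalue_of_hasEigenvector
      (x := fun t : Fin (T + 1) => cos ((n : ℕ) * π / (T + 1) * ((t : ℕ) + 1 / 2)))
      (Module.End.hasEigenvector_iff.mpr ⟨Module.End.mem_eigenspace_iff.mpr ?_, fun h => ?_⟩)
    · rw [Matrix.toLin'_apply]
      exact hopping_mulVec_cos T hT E hE n _ (div_mul_cancel₀ _ hpos.ne')
    · have h₀ := congrFun h 0
      have hn := hnonneg n
      have hn' := hlt n
      refine (cos_pos_of_mem_Ioo ⟨?_, ?_⟩).ne' h₀ <;> simp only [Fin.val_zero, Nat.cast_zero] <;>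
        linarith
  choose f hf using hmem
  have hfinj : Function.Injective f := fun m n h => hinj (by
    simp only [← hf, h])
  exact ⟨hinj, Equiv.ofBijective f (Finite.injective_iff_bijective.mp hfinj), hf⟩
end

section
/- Let T ≥ 1 and let E be the (T+1)×(T+1) real symmetric tridiagonal matrix with diagonal entries E₀₀ = E_TT = 1/2 and E_tt = 1 for 0 < t < T, off-diagonal entries E_{t,t+1} = E_{t+1,t} = −1/2 for 0 ≤ t < T, and all other entries zero. Then for every vector x ∈ ℝ^{T+1} orthogonal to the all-ones vector (i.e., with Σ_t x_t = 0), one has xᵀEx ≥ (1 − cos(π/(T+1)))·‖x‖². In other words, E has a spectral gap of 1 − cos(π/(T+1)) above its zero ground-state eigenvalue. -/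
open Matrix Real

/-- Jacobi-type lower bound for the Dirichlet energy of a sequence vanishing at `0`, obtained by
comparison with `k ↦ sin (k θ)`. -/
lemma dirichlet_energy_lower_bound (θ : ℝ) (y : ℕ → ℝ) (h0 : y 0 = 0) (n : ℕ)
    (hs : ∀ k ≤ n, 0 < sin ((k + 1 : ℝ) * θ)) :
    2 * (1 - cos θ) * ∑ t ∈ Finset.range (n + 1), y (t + 1) ^ 2
        + (sin ((n + 2 : ℝ) * θ) / sin ((n + 1 : ℝ) * θ) - 1) * y (n + 1) ^ 2
      ≤ ∑ t ∈ Finset.range (n + 1), (y (t + 1) - y t) ^ 2 := by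
  induction n with
  | zero =>
    have h := hs 0 le_rfl
    simp only [Nat.cast_zero, zero_add, one_mul] at h
    simp only [zero_add, Finset.sum_range_one, h0, Nat.cast_zero, one_mul, sin_two_mul]
    apply le_of_eq
    field_simp
    ring
  | succ n ih =>
    have ih := ih fun k hk => hs k (by omega)
    have ha := hs n (by omega)
    have hb := hs (n + 1) le_rfl
    have hrec : sin ((n + 1 + 2 : ℝ) * θ)
        = 2 * cos θ * sin ((n + 1 + 1 : ℝ) * θ) - sin ((n + 1 : ℝ) * θ) := by
      have e1 : (n + 1 + 2 : ℝ) * θ = (n + 1 + 1 : ℝ) * θ + θ := by ring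
      have e2 : (n + 1 : ℝ) * θ = (n + 1 + 1 : ℝ) * θ - θ := by ring
      rw [e1, e2, sin_add, sin_sub]
      ring
    rw [Finset.sum_range_succ, Finset.sum_range_succ _ (n + 1)]
    push_cast at hb ⊢
    rw [hrec]
    rw [show (n + 2 : ℝ) = n + 1 + 1 by ring] at ih
    generalize sin ((n + 1 : ℝ) * θ) = a at *
    generalize sin ((n + 1 + 1 : ℝ) * θ) = b at *
    generalize y (n + 1) = u at *
    generalize y (n + 1 + 1) = v at *
    have key : 0 ≤ (b * u - a * v) ^ 2 / (a * b) := by positivity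
    have e : (b * u - a * v) ^ 2 / (a * b) = b / a * u ^ 2 - 2 * u * v + a / b * v ^ 2 := by
      field_simp
      ring
    have e' : (2 * cos θ * b - a) / b = 2 * cos θ - a / b := by
      field_simp
    rw [e']
    nlinarith

/-- The discrete Wirtinger inequality with Dirichlet boundary conditions. -/
lemma wirtinger_dirichlet (T : ℕ) (hT : 1 ≤ T) (y : ℕ → ℝ) (h0 : y 0 = 0) (hN : y (T + 1) = 0) :
    2 * (1 - cos (π / (T + 1))) * ∑ t ∈ Finset.range T, y (t + 1) ^ 2
      ≤ ∑ t ∈ Finset.range (T + 1), (y (t + 1) - y t) ^ 2 := by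
  obtain ⟨n, rfl⟩ : ∃ n, T = n + 1 := ⟨T - 1, by omega⟩
  have hpos : (0 : ℝ) < ((n + 1 : ℕ) : ℝ) + 1 := by positivity
  have h := dirichlet_energy_lower_bound (π / ((n + 1 : ℕ) + 1)) y h0 n (by
    intro k hk
    have hk' : (k : ℝ) ≤ n := by exact_mod_cast hk
    apply sin_pos_of_pos_of_lt_pi
    · positivity
    · rw [← mul_div_assoc, div_lt_iff₀ hpos, mul_comm]
      push_cast
      exact mul_lt_mul_of_pos_left (by linarith) pi_pos)
  have hsin : sin ((n + 2 : ℝ) * (π / ((n + 1 : ℕ) + 1))) = 0 := by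
    rw [show (n + 2 : ℝ) * (π / ((n + 1 : ℕ) + 1)) = π by push_cast; field_simp; ring, sin_pi]
  rw [hsin, zero_div] at h
  rw [Finset.sum_range_succ _ (n + 1), hN]
  linarith

/-- The discrete Wirtinger inequality for sequences with vanishing mean. -/
lemma wirtinger_mean_zero (T : ℕ) (hT : 1 ≤ T) (f : ℕ → ℝ)
    (hf : ∑ t ∈ Finset.range (T + 1), f t = 0) :
    2 * (1 - cos (π / (T + 1))) * ∑ t ∈ Finset.range (T + 1), f t ^ 2
      ≤ ∑ t ∈ Finset.range T, (f (t + 1) - f t) ^ 2 := by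
  set c := 2 * (1 - cos (π / (T + 1))) with hc
  have hc0 : 0 ≤ c := by have := cos_le_one (π / (T + 1)); linarith
  let y : ℕ → ℝ := fun n => ∑ t ∈ Finset.range n, f t
  have hy (t : ℕ) : y (t + 1) - y t = f t := by simp [y, Finset.sum_range_succ]
  have hD := wirtinger_dirichlet T hT y (by simp [y]) hf
  simp only [hy, ← hc] at hD
  have parts (n : ℕ) : ∑ t ∈ Finset.range (n + 1), f t ^ 2
      = f n * y (n + 1) - ∑ t ∈ Finset.range n, (f (t + 1) - f t) * y (t + 1) := by
    induction n with
    | zero => simp [y, sq]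
    | succ n ih =>
      rw [Finset.sum_range_succ, ih, Finset.sum_range_succ _ n]
      linear_combination (-f (n + 1)) * hy (n + 1)
  have hX := parts T
  rw [show y (T + 1) = 0 from hf] at hX
  have hsq : 0 ≤ ∑ t ∈ Finset.range T, ((f (t + 1) - f t) + c * y (t + 1)) ^ 2 :=
    Finset.sum_nonneg fun _ _ => sq_nonneg _
  have hexp : ∑ t ∈ Finset.range T, ((f (t + 1) - f t) + c * y (t + 1)) ^ 2
      = ∑ t ∈ Finset.range T, (f (t + 1) - f t) ^ 2
        + 2 * c * ∑ t ∈ Finset.range T, (f (t + 1) - f t) * y (t + 1)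
        + c ^ 2 * ∑ t ∈ Finset.range T, y (t + 1) ^ 2 := by
    rw [Finset.mul_sum, Finset.mul_sum, ← Finset.sum_add_distrib, ← Finset.sum_add_distrib]
    exact Finset.sum_congr rfl fun _ _ => by ring
  have := mul_le_mul_of_nonneg_left hD hc0
  nlinarith

/-- The quadratic form of the hopping matrix is half the Dirichlet energy on a path. -/
lemma hopping_quadratic_form (T : ℕ) (hT : 1 ≤ T) (f : ℕ → ℝ) :
    ∑ t ∈ Finset.range (T + 1), ∑ s ∈ Finset.range (T + 1),
      f t * ((if t = s then (if t = 0 ∨ t = T then (1 : ℝ) / 2 else 1)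
        else if t + 1 = s ∨ s + 1 = t then -(1 / 2) else 0) * f s)
      = 1 / 2 * ∑ t ∈ Finset.range T, (f (t + 1) - f t) ^ 2 := by
  have hsplit (t s : ℕ) (ht : t ∈ Finset.range (T + 1)) :
      f t * ((if t = s then (if t = 0 ∨ t = T then (1 : ℝ) / 2 else 1)
        else if t + 1 = s ∨ s + 1 = t then -(1 / 2) else 0) * f s)
      = (if t = s then f t ^ 2 * ((if t = T then 0 else 1 / 2) + (if t = 0 then 0 else 1 / 2))
          else 0)
        - 1 / 2 * (if t + 1 = s then f t * f (t + 1) else 0)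
        - 1 / 2 * (if s + 1 = t then f s * f (s + 1) else 0) := by
    split_ifs <;> first | omega | (subst_vars; ring)
  have hcross : ∑ t ∈ Finset.range (T + 1), ∑ s ∈ Finset.range (T + 1),
      (if t + 1 = s then f t * f (t + 1) else 0) = ∑ t ∈ Finset.range T, f t * f (t + 1) := by
    rw [Finset.sum_range_succ]
    simp only [Finset.sum_ite_eq, Finset.mem_range, lt_irrefl, if_false, add_zero]
    exact Finset.sum_congr rfl fun t ht => if_pos (by simpa using ht)
  have hcross' : ∑ t ∈ Finset.range (T + 1), ∑ s ∈ Finset.range (T + 1),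
      (if s + 1 = t then f s * f (s + 1) else 0) = ∑ t ∈ Finset.range T, f t * f (t + 1) := by
    rw [Finset.sum_comm, hcross]
  have hdiag : ∑ t ∈ Finset.range (T + 1), ∑ s ∈ Finset.range (T + 1),
      (if t = s then f t ^ 2 * ((if t = T then 0 else 1 / 2) + (if t = 0 then 0 else 1 / 2))
          else 0)
      = 1 / 2 * ∑ t ∈ Finset.range T, f t ^ 2 + 1 / 2 * ∑ t ∈ Finset.range T, f (t + 1) ^ 2 := by
    simp only [Finset.sum_ite_eq]
    rw [Finset.sum_congr rfl fun t ht => if_pos ht]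
    simp only [mul_add, Finset.sum_add_distrib, Finset.mul_sum]
    congr 1
    · rw [Finset.sum_range_succ]
      simp only [if_true, mul_zero, add_zero]
      refine Finset.sum_congr rfl fun t ht => ?_
      rw [if_neg (Finset.mem_range.1 ht).ne, mul_comm]
    · rw [Finset.sum_range_succ']
      simp [mul_comm]
  rw [Finset.sum_congr rfl fun t ht => Finset.sum_congr rfl fun s _ => hsplit t s ht]
  simp only [Finset.sum_sub_distrib, ← Finset.mul_sum]
  rw [hdiag, hcross, hcross']
  simp only [Finset.mul_sum, ← Finset.sum_sub_distrib, ← Finset.sum_add_distrib]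
  exact Finset.sum_congr rfl fun _ _ => by ring

/-- Spectral gap of the hopping matrix: for every x orthogonal to the all-ones vector,
xᵀEx ≥ (1 − cos(π/(T+1)))·‖x‖². -/
theorem hopping_matrix_spectral_gap
    (T : ℕ) (hT : 1 ≤ T) (E : Matrix (Fin (T + 1)) (Fin (T + 1)) ℝ)
    (hE : ∀ t s : Fin (T + 1), E t s =
      if t = s then (if (t : ℕ) = 0 ∨ (t : ℕ) = T then (1 : ℝ) / 2 else 1)
      else if (t : ℕ) + 1 = (s : ℕ) ∨ (s : ℕ) + 1 = (t : ℕ) then -(1 / 2) else 0) :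
    ∀ x : Fin (T + 1) → ℝ, (∑ t, x t) = 0 →
      (1 - Real.cos (π / (T + 1))) * (∑ t, x t ^ 2) ≤ x ⬝ᵥ E.mulVec x := by
  intro x hx
  let f : ℕ → ℝ := fun i => if h : i < T + 1 then x ⟨i, h⟩ else 0
  have hfx (t : Fin (T + 1)) : x t = f t := by simp only [f, t.is_lt, dite_true, Fin.eta]
  have hform : x ⬝ᵥ E.mulVec x = 1 / 2 * ∑ t ∈ Finset.range T, (f (t + 1) - f t) ^ 2 := by
    rw [← hopping_quadratic_form T hT, Finset.sum_range]
    simp only [dotProduct, mulVec, Finset.mul_sum, Finset.sum_range, hE, hfx, Fin.ext_iff]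
  simp only [hfx, ← Finset.sum_range] at hx
  have h := wirtinger_mean_zero T hT f hx
  rw [hform]
  simp only [hfx]
  rw [← Finset.sum_range fun i => f i ^ 2]
  linarith
end

section
/- Let T ≥ 1 and let E′ be the (T+1)×(T+1) real symmetric tridiagonal matrix with diagonal entries E′₀₀ = 1/2, E′_tt = 1 for 0 < t < T, E′_TT = 3/2, off-diagonal entries E′_{t,t+1} = E′_{t+1,t} = −1/2 for 0 ≤ t < T, and all other entries zero. Then for every vector x ∈ ℝ^{T+1}, one has xᵀE′x ≥ (1 − cos(π/(2T+3)))·‖x‖²; that is, the smallest eigenvalue of E′ is at least 1 − cos(π/(2T+3)) > 0. -/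
open Matrix Real

/-- The quadratic form of a tridiagonal array with diagonal `a` and off-diagonal entries `-1/2`. -/
lemma sum_sum_tridiagonal (a y : ℕ → ℝ) (N : ℕ) :
    ∑ t ∈ Finset.range (N + 1), ∑ s ∈ Finset.range (N + 1),
      y t * ((if t = s then a t else if t + 1 = s ∨ s + 1 = t then -(1 / 2) else 0) * y s) =
    ∑ t ∈ Finset.range N, (a t * y t ^ 2 - y t * y (t + 1)) + a N * y N ^ 2 := by
  have split : ∀ t s : ℕ,
      y t * ((if t = s then a t else if t + 1 = s ∨ s + 1 = t then -(1 / 2) else 0) * y s) =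
      (if t = s then a t * y t * y s else 0) + (if t + 1 = s then -(1 / 2) * y t * y s else 0) +
        (if s + 1 = t then -(1 / 2) * y t * y s else 0) := by
    intro t s
    split_ifs <;> first | omega | ring
  have shifted : ∑ t ∈ Finset.range (N + 1), ∑ s ∈ Finset.range (N + 1),
      (if t + 1 = s then -(1 / 2) * y t * y s else 0) =
      ∑ t ∈ Finset.range N, -(1 / 2) * y t * y (t + 1) := by
    simp only [Finset.sum_ite_eq, Finset.mem_range]
    rw [Finset.sum_range_succ, if_neg (lt_irrefl _), add_zero]
    refine Finset.sum_congr rfl fun t ht => if_pos ?_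
    simpa using ht
  have shifted' : ∑ t ∈ Finset.range (N + 1), ∑ s ∈ Finset.range (N + 1),
      (if s + 1 = t then -(1 / 2) * y t * y s else 0) =
      ∑ t ∈ Finset.range N, -(1 / 2) * y t * y (t + 1) := by
    rw [Finset.sum_comm, ← shifted]
    refine Finset.sum_congr rfl fun t _ => Finset.sum_congr rfl fun s _ => ?_
    split_ifs <;> ring
  have diagonal : ∑ t ∈ Finset.range (N + 1), ∑ s ∈ Finset.range (N + 1),
      (if t = s then a t * y t * y s else 0) = ∑ t ∈ Finset.range (N + 1), a t * y t ^ 2 := by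
    refine Finset.sum_congr rfl fun t ht => ?_
    rw [Finset.sum_ite_eq, if_pos ht]
    ring
  simp only [split, Finset.sum_add_distrib]
  rw [diagonal, shifted, shifted', Finset.sum_range_succ, add_assoc, ← Finset.sum_add_distrib,
    add_right_comm, ← Finset.sum_add_distrib]
  congr 1
  exact Finset.sum_congr rfl fun t _ => by ring

lemma two_mul_cos_mul_cos_half_shift (θ n : ℝ) :
    2 * cos θ * cos ((n + 1 / 2) * θ) = cos ((n - 1 / 2) * θ) + cos ((n + 3 / 2) * θ) := by
  rw [show (n - 1 / 2) * θ = (n + 1 / 2) * θ - θ by ring,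
    show (n + 3 / 2) * θ = (n + 1 / 2) * θ + θ by ring, cos_sub, cos_add]
  ring

/-- Completing the square with weights `p, q > 0`. -/
lemma mul_le_half_div_mul_sq_add {p q : ℝ} (hp : 0 < p) (hq : 0 < q) (u v : ℝ) :
    u * v ≤ q / (2 * p) * u ^ 2 + p / (2 * q) * v ^ 2 := by
  have key : q / (2 * p) * u ^ 2 + p / (2 * q) * v ^ 2 - u * v =
      (q * u - p * v) ^ 2 / (2 * p * q) := by
    field_simp
    ring
  have : 0 ≤ (q * u - p * v) ^ 2 / (2 * p * q) := by positivity
  linarith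

/-- Lower bound for the partial quadratic forms, with the positive comparison vector
`cos ((t + 1/2) θ)`. -/
lemma neg_cos_div_mul_sq_le_sum {θ : ℝ} {T : ℕ}
    (hpos : ∀ n : ℕ, n ≤ T → 0 < cos ((n + 1 / 2) * θ)) {a : ℕ → ℝ} (ha₀ : a 0 = 1 / 2)
    (ha : ∀ t, 0 < t → t < T → a t = 1) (y : ℕ → ℝ) (n : ℕ) (hn : n + 1 ≤ T) :
    -(cos ((n + 1 / 2) * θ) / (2 * cos ((n + 3 / 2) * θ))) * y (n + 1) ^ 2 ≤
      ∑ t ∈ Finset.range (n + 1), ((a t - (1 - cos θ)) * y t ^ 2 - y t * y (t + 1)) := by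
  have hp := hpos n (by omega)
  have hq : 0 < cos ((n + 3 / 2) * θ) := by
    have h := hpos (n + 1) hn
    push_cast at h
    rwa [show (n : ℝ) + 1 + 1 / 2 = n + 3 / 2 by ring] at h
  have hsq := mul_le_half_div_mul_sq_add hp hq (y n) (y (n + 1))
  have hrec := two_mul_cos_mul_cos_half_shift θ n
  rw [Finset.sum_range_succ]
  cases n with
  | zero =>
    have hcoef : a 0 - (1 - cos θ) =
        cos (((0 : ℕ) + 3 / 2) * θ) / (2 * cos (((0 : ℕ) + 1 / 2) * θ)) := by
      have hsymm : cos ((((0 : ℕ) : ℝ) - 1 / 2) * θ) = cos ((((0 : ℕ) : ℝ) + 1 / 2) * θ) := by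
        rw [← cos_neg]
        congr 1
        push_cast
        ring
      rw [hsymm] at hrec
      rw [ha₀, eq_div_iff (by positivity)]
      linear_combination hrec
    rw [hcoef, Finset.sum_range_zero]
    linarith
  | succ m =>
    have ih := neg_cos_div_mul_sq_le_sum hpos ha₀ ha y m (by omega)
    have hm : (m : ℝ) + 3 / 2 = ((m + 1 : ℕ) : ℝ) + 1 / 2 := by push_cast; ring
    have hm' : (m : ℝ) + 1 / 2 = ((m + 1 : ℕ) : ℝ) - 1 / 2 := by push_cast; ring
    rw [hm, hm'] at ih
    have hcoef : a (m + 1) - (1 - cos θ) =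
        cos ((((m + 1 : ℕ) : ℝ) - 1 / 2) * θ) / (2 * cos ((((m + 1 : ℕ) : ℝ) + 1 / 2) * θ)) +
        cos ((((m + 1 : ℕ) : ℝ) + 3 / 2) * θ) / (2 * cos ((((m + 1 : ℕ) : ℝ) + 1 / 2) * θ)) := by
      rw [ha (m + 1) (by omega) (by omega), ← add_div, eq_div_iff (by positivity)]
      linear_combination hrec
    rw [hcoef]
    linarith

/-- The penalized hopping matrix E′ satisfies xᵀE′x ≥ (1 − cos(π/(2T+3)))·‖x‖² for all x;
in particular its smallest eigenvalue is at least 1 − cos(π/(2T+3)) > 0. -/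
theorem penalized_hopping_matrix_ground_energy
    (T : ℕ) (hT : 1 ≤ T) (E' : Matrix (Fin (T + 1)) (Fin (T + 1)) ℝ)
    (hE' : ∀ t s : Fin (T + 1), E' t s =
      if t = s then
        (if (t : ℕ) = 0 then (1 : ℝ) / 2 else if (t : ℕ) = T then 3 / 2 else 1)
      else if (t : ℕ) + 1 = (s : ℕ) ∨ (s : ℕ) + 1 = (t : ℕ) then -(1 / 2) else 0) :
    (∀ x : Fin (T + 1) → ℝ,
      (1 - Real.cos (π / (2 * T + 3))) * (∑ t, x t ^ 2) ≤ x ⬝ᵥ E'.mulVec x) ∧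
      0 < 1 - Real.cos (π / (2 * T + 3)) := by
  set θ : ℝ := π / (2 * T + 3) with hθ
  have hθ_pos : 0 < θ := by positivity
  have hθ_mul : (2 * T + 3) * θ = π := by rw [hθ]; field_simp
  have hθ_le : θ ≤ π := by nlinarith [(Nat.cast_nonneg T : (0 : ℝ) ≤ T)]
  have hpos : ∀ n : ℕ, n ≤ T → 0 < cos ((n + 1 / 2) * θ) := by
    intro n hn
    have hn' : (n : ℝ) ≤ T := by exact_mod_cast hn
    have hlow : 0 ≤ ((n : ℝ) + 1 / 2) * θ := by positivity
    exact cos_pos_of_mem_Ioo ⟨by linarith [pi_pos], by nlinarith⟩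
  refine ⟨fun x => ?_, ?_⟩
  · let y : ℕ → ℝ := fun n => if h : n < T + 1 then x ⟨n, h⟩ else 0
    let a : ℕ → ℝ := fun t => if t = 0 then 1 / 2 else if t = T then 3 / 2 else 1
    have hy : ∀ t : Fin (T + 1), x t = y t := fun t => by simp only [y, t.isLt, dite_true]
    have hform : x ⬝ᵥ E'.mulVec x =
        ∑ t ∈ Finset.range T, (a t * y t ^ 2 - y t * y (t + 1)) + a T * y T ^ 2 := by
      rw [← sum_sum_tridiagonal, Finset.sum_range]
      simp only [Finset.sum_range, dotProduct, mulVec, Finset.mul_sum, hE', hy, Fin.ext_iff, a]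
    have hnorm : ∑ t, x t ^ 2 = ∑ t ∈ Finset.range T, y t ^ 2 + y T ^ 2 := by
      rw [← Finset.sum_range_succ, Finset.sum_range]
      simp only [hy]
    have haT : a T = 3 / 2 := by
      simp only [a, if_true]
      rw [if_neg (by omega)]
    obtain ⟨m, rfl⟩ : ∃ m, T = m + 1 := ⟨T - 1, by omega⟩
    have hbound := neg_cos_div_mul_sq_le_sum hpos (a := a) (by simp [a])
      (fun t h₀ h₁ => by simp only [a]; rw [if_neg (by omega), if_neg (by omega)]) y m le_rfl
    have hq := hpos (m + 1) le_rfl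
    have hrec := two_mul_cos_mul_cos_half_shift θ ((m + 1 : ℕ) : ℝ)
    have hm : (m : ℝ) + 3 / 2 = ((m + 1 : ℕ) : ℝ) + 1 / 2 := by push_cast; ring
    have hm' : (m : ℝ) + 1 / 2 = ((m + 1 : ℕ) : ℝ) - 1 / 2 := by push_cast; ring
    rw [hm, hm'] at hbound
    have hlast : cos ((((m + 1 : ℕ) : ℝ) + 3 / 2) * θ) = 0 := by
      rw [← cos_pi_div_two, ← hθ_mul]
      congr 1
      ring
    have hcoef : cos ((((m + 1 : ℕ) : ℝ) - 1 / 2) * θ) /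
        (2 * cos ((((m + 1 : ℕ) : ℝ) + 1 / 2) * θ)) = cos θ := by
      rw [div_eq_iff (by positivity)]
      linear_combination -hrec - hlast
    rw [hcoef] at hbound
    have hsplit : ∑ t ∈ Finset.range (m + 1),
        ((a t - (1 - cos θ)) * y t ^ 2 - y t * y (t + 1)) =
        ∑ t ∈ Finset.range (m + 1), (a t * y t ^ 2 - y t * y (t + 1)) -
        (1 - cos θ) * ∑ t ∈ Finset.range (m + 1), y t ^ 2 := by
      rw [Finset.mul_sum, ← Finset.sum_sub_distrib]
      exact Finset.sum_congr rfl fun t _ => by ring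
    rw [hform, hnorm, haT]
    linarith [sq_nonneg (y (m + 1))]
  · have h := cos_lt_cos_of_nonneg_of_le_pi le_rfl hθ_le hθ_pos
    rw [cos_zero] at h
    linarith
end
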